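/- arXiv:2408.07899 — 3 statements merged into one kernel-verified Lean document; each statement's English description precedes it below -/
import Mathlib

section
/- Existence of a graded Smith Normal Decomposition: let M ∈ Matrix (Fin m) (Fin n) K[X] be graded-homogeneous with respect to (a, s). Then there exist invertible matrices U ∈ GL (Fin m) K[X] and V ∈ GL (Fin n) K[X], degree vectors b : Fin m → ℕ and c : Fin n → ℕ, a natural number r ≤ min m n, and a monotone nondecreasing function t : Fin r → ℕ such that: (1) U is graded-homogeneous with respect to (a, b) and V is graded-homogeneous with respect to (s, c); (2) the matrix D := U⁻¹ * M * V satisfies D j i = 0 whenever j ≠ i (as natural numbers); (3) D j j = X^(t j) for every diagonal index j < r, and D j j = 0 for every diagonal index j ≥ r. In particular the nonzero diagonal entries d₁, …, d_r of D are homogeneous and satisfy d₁ ∣ d₂ ∣ ⋯ ∣ d_r, so D is in Smith Normal Form. -/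
open Polynomial

/-- A matrix over `K[X]` is graded-homogeneous with respect to degree vectors `(a, s)`
if each nonzero entry is a monomial whose degree is the difference of the column degree
and the row degree. -/
def Matrix.IsGradedHomog {K : Type*} [Field K] {m n : ℕ} (a : Fin m → ℕ) (s : Fin n → ℕ)
    (M : Matrix (Fin m) (Fin n) K[X]) : Prop :=
  ∀ j i, M j i = 0 ∨
    (a j ≤ s i ∧ ∃ c : K, c ≠ 0 ∧ M j i = C c * X ^ (s i - a j))

namespace Matrix

variable {K : Type*} [Field K] {m n : ℕ}

theorem isGradedHomog_iff {a : Fin m → ℕ} {s : Fin n → ℕ} {M : Matrix (Fin m) (Fin n) K[X]} :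
    M.IsGradedHomog a s ↔
      ∀ j i, ∃ c : K, X ^ a j * M j i = C c * X ^ s i := by
  refine forall₂_congr fun j i => ⟨?_, ?_⟩
  · rintro (h | ⟨h, c, -, hc⟩)
    · exact ⟨0, by simp [h]⟩
    · refine ⟨c, ?_⟩
      rw [hc, mul_left_comm, ← pow_add, Nat.add_sub_cancel' h]
  · rintro ⟨c, hc⟩
    have hX : (X ^ a j : K[X]) ≠ 0 := pow_ne_zero _ X_ne_zero
    by_cases h0 : c = 0
    · left
      simpa [h0, hX] using hc
    · right
      have hle : a j ≤ s i := by
        by_contra! hlt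
        have h := congrArg (fun p => coeff p (s i)) hc
        exact h0 (by simpa [coeff_X_pow_mul', hlt.not_ge] using h.symm)
      refine ⟨hle, c, h0, mul_left_cancel₀ hX ?_⟩
      rw [hc, mul_left_comm, ← pow_add, Nat.add_sub_cancel' hle]

theorem IsGradedHomog.one (a : Fin m → ℕ) :
    (1 : Matrix (Fin m) (Fin m) K[X]).IsGradedHomog a a := by
  intro j i
  rcases eq_or_ne j i with rfl | h
  · exact .inr ⟨le_rfl, 1, one_ne_zero, by simp⟩
  · exact .inl (one_apply_ne h)

theorem IsGradedHomog.submatrix {m' n' : ℕ} {a : Fin m → ℕ} {s : Fin n → ℕ}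
    {M : Matrix (Fin m) (Fin n) K[X]} (hM : M.IsGradedHomog a s) (f : Fin m' → Fin m)
    (g : Fin n' → Fin n) : (M.submatrix f g).IsGradedHomog (a ∘ f) (s ∘ g) :=
  fun j i => hM (f j) (g i)

theorem IsGradedHomog.add {a : Fin m → ℕ} {s : Fin n → ℕ} {M N : Matrix (Fin m) (Fin n) K[X]}
    (hM : M.IsGradedHomog a s) (hN : N.IsGradedHomog a s) : (M + N).IsGradedHomog a s := by
  rw [isGradedHomog_iff] at *
  intro j i
  obtain ⟨c, hc⟩ := hM j i
  obtain ⟨d, hd⟩ := hN j i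
  exact ⟨c + d, by rw [add_apply, mul_add, hc, hd, C_add, add_mul]⟩

theorem IsGradedHomog.mul {l : ℕ} {a : Fin l → ℕ} {b : Fin m → ℕ} {s : Fin n → ℕ}
    {M : Matrix (Fin l) (Fin m) K[X]} {N : Matrix (Fin m) (Fin n) K[X]}
    (hM : M.IsGradedHomog a b) (hN : N.IsGradedHomog b s) : (M * N).IsGradedHomog a s := by
  rw [isGradedHomog_iff] at *
  choose A hA using hM
  choose B hB using hN
  refine fun j i => ⟨∑ x, A j x * B x i, ?_⟩
  rw [mul_apply, Finset.mul_sum, map_sum, Finset.sum_mul]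
  refine Finset.sum_congr rfl fun x _ => ?_
  rw [← mul_assoc, hA, mul_assoc, hB, C_mul, mul_assoc]

/-- `M`, with degrees `(a, s)`, is carried to the graded-homogeneous matrix `N`, with degrees
`(b, c)`, by graded-homogeneous changes of basis. -/
def GradedEquiv (a : Fin m → ℕ) (s : Fin n → ℕ) (M : Matrix (Fin m) (Fin n) K[X])
    (b : Fin m → ℕ) (c : Fin n → ℕ) (N : Matrix (Fin m) (Fin n) K[X]) : Prop :=
  N.IsGradedHomog b c ∧ ∃ (U : GL (Fin m) K[X]) (V : GL (Fin n) K[X]),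
    IsGradedHomog a b (U : Matrix (Fin m) (Fin m) K[X]) ∧
    IsGradedHomog s c (V : Matrix (Fin n) (Fin n) K[X]) ∧
    M * (V : Matrix (Fin n) (Fin n) K[X]) = (U : Matrix (Fin m) (Fin m) K[X]) * N

theorem IsGradedHomog.gradedEquiv_self {a : Fin m → ℕ} {s : Fin n → ℕ}
    {M : Matrix (Fin m) (Fin n) K[X]} (hM : M.IsGradedHomog a s) : GradedEquiv a s M a s M :=
  ⟨hM, 1, 1, by simpa using .one a, by simpa using .one s, by simp⟩

theorem GradedEquiv.trans {a b d : Fin m → ℕ} {s c e : Fin n → ℕ}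
    {M N P : Matrix (Fin m) (Fin n) K[X]} (h : GradedEquiv a s M b c N)
    (h' : GradedEquiv b c N d e P) : GradedEquiv a s M d e P := by
  obtain ⟨-, U, V, hU, hV, hUV⟩ := h
  obtain ⟨hP, U', V', hU', hV', hUV'⟩ := h'
  refine ⟨hP, U * U', V * V', ?_, ?_, ?_⟩
  · simpa using hU.mul hU'
  · simpa using hV.mul hV'
  · simp only [Units.val_mul]
    rw [← Matrix.mul_assoc, hUV, Matrix.mul_assoc, hUV', Matrix.mul_assoc]

theorem IsGradedHomog.gradedEquiv_submatrix {a : Fin m → ℕ} {s : Fin n → ℕ}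
    {M : Matrix (Fin m) (Fin n) K[X]} (hM : M.IsGradedHomog a s) (σ : Equiv.Perm (Fin m))
    (τ : Equiv.Perm (Fin n)) :
    GradedEquiv a s M (a ∘ σ) (s ∘ τ) (M.submatrix σ τ) := by
  have hinv {l : ℕ} (ρ : Equiv.Perm (Fin l)) :
      IsUnit ((1 : Matrix (Fin l) (Fin l) K[X]).submatrix id ρ) := by
    refine (isUnit_iff_isUnit_det _).2 ?_
    rw [det_permute', det_one, mul_one]
    exact (Equiv.Perm.sign ρ).isUnit.map (Int.castRingHom K[X])
  refine ⟨hM.submatrix σ τ, (hinv σ).unit, (hinv τ).unit, (IsGradedHomog.one a).submatrix id σ,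
    (IsGradedHomog.one s).submatrix id τ, ?_⟩
  simp only [IsUnit.unit_spec]
  rw [submatrix_mul_equiv, Matrix.one_mul]
  exact mul_submatrix_one (Equiv.refl _) τ M

/-- Clearing the row and the column of an entry that divides all of their entries. -/
theorem IsGradedHomog.exists_gradedEquiv_clear {a : Fin m → ℕ} {s : Fin n → ℕ}
    {M : Matrix (Fin m) (Fin n) K[X]} (hM : M.IsGradedHomog a s) {j₀ : Fin m} {i₀ : Fin n}
    {c : K} (hc : c ≠ 0) {d : ℕ} (hd : M j₀ i₀ = C c * X ^ d)
    (hcol : ∀ j, X ^ d ∣ M j i₀) (hrow : ∀ i, X ^ d ∣ M j₀ i) :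
    ∃ (v : Fin n → K[X]) (N : Matrix (Fin m) (Fin n) K[X]), GradedEquiv a s M a s N ∧
      (∀ i, M j₀ i = 0 → v i = 0) ∧ N j₀ i₀ = X ^ d ∧ (∀ j, j ≠ j₀ → N j i₀ = 0) ∧
      (∀ i, i ≠ i₀ → N j₀ i = 0) ∧
      ∀ j i, j ≠ j₀ → i ≠ i₀ → N j i = M j i + M j i₀ * v i := by
  have hX : (X ^ d : K[X]) ≠ 0 := pow_ne_zero _ X_ne_zero
  have hCc : C c * C c⁻¹ = 1 := by rw [← C_mul, mul_inv_cancel₀ hc, C_1]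
  have hdeg : s i₀ = a j₀ + d := by
    obtain h | ⟨hle, e, he, h⟩ := hM j₀ i₀
    · simp [hd, hc] at h
    · have h' := congrArg natDegree (hd.symm.trans h)
      rw [natDegree_C_mul_X_pow _ _ hc, natDegree_C_mul_X_pow _ _ he] at h'
      omega
  have hA := isGradedHomog_iff.1 hM
  choose A hA using hA
  choose p hp using hcol
  choose q hq using hrow
  set u : Fin m → K[X] := fun j => if j = j₀ then C (c - 1) else p j with hu
  set v : Fin n → K[X] := fun i => if i = i₀ then 0 else -(C c⁻¹ * q i) with hv
  set N : Matrix (Fin m) (Fin n) K[X] := of fun j i =>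
    if j = j₀ then (if i = i₀ then X ^ d else 0)
    else if i = i₀ then 0 else M j i + M j i₀ * v i with hN
  have hpA (j) : X ^ a j * p j = C (A j i₀) * X ^ a j₀ := by
    apply mul_left_cancel₀ hX
    have := hA j i₀
    rw [hp, hdeg, pow_add] at this
    linear_combination this
  have hqA (i) : X ^ s i₀ * q i = C (A j₀ i) * X ^ s i := by
    have := hA j₀ i
    rw [hq] at this
    rw [hdeg, pow_add, ← this]
    ring
  have hvA (i) : ∃ e : K, X ^ s i₀ * v i = C e * X ^ s i := by
    by_cases h : i = i₀
    · exact ⟨0, by simp [hv, h]⟩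
    · refine ⟨-(c⁻¹ * A j₀ i), ?_⟩
      simp only [hv, h, if_false, C_neg, C_mul]
      linear_combination (-C c⁻¹) * hqA i
  have hU : IsUnit (1 + vecMulVec u (Pi.single j₀ 1)) := by
    refine (isUnit_iff_isUnit_det _).2 ?_
    rw [vecMulVec_eq Unit, det_one_add_replicateCol_mul_replicateRow]
    simpa [hu] using hc
  have hV : IsUnit (1 + vecMulVec (Pi.single i₀ 1) v) := by
    refine (isUnit_iff_isUnit_det _).2 ?_
    rw [vecMulVec_eq Unit, det_one_add_replicateCol_mul_replicateRow]
    simp [hv]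
  refine ⟨v, N, ⟨?_, hU.unit, hV.unit, .add (.one a) ?_, .add (.one s) ?_, ?_⟩, ?_, ?_, ?_, ?_, ?_⟩
  · rw [isGradedHomog_iff]
    intro j i
    by_cases hj : j = j₀ <;> by_cases hi : i = i₀
    · exact ⟨1, by simp [hN, hj, hi, hdeg, pow_add]⟩
    · exact ⟨0, by simp [hN, hj, hi]⟩
    · exact ⟨0, by simp [hN, hj, hi]⟩
    · obtain ⟨e, he⟩ := hvA i
      refine ⟨A j i + A j i₀ * e, ?_⟩
      simp only [hN, of_apply, hj, hi, if_false, C_add, C_mul]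
      linear_combination hA j i + v i * hA j i₀ + C (A j i₀) * he
  · rw [isGradedHomog_iff]
    intro j i
    by_cases hi : i = j₀
    · subst hi
      by_cases hj : j = i
      · exact ⟨c - 1, by simp [vecMulVec_apply, hu, hj, mul_comm]⟩
      · exact ⟨A j i₀, by simp [vecMulVec_apply, hu, hj, hpA]⟩
    · exact ⟨0, by simp [vecMulVec_apply, hi]⟩
  · rw [isGradedHomog_iff]
    intro j i
    by_cases hj : j = i₀
    · subst hj
      simpa [vecMulVec_apply] using hvA i
    · exact ⟨0, by simp [vecMulVec_apply, hj]⟩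
  · ext j i : 1
    simp only [IsUnit.unit_spec, Matrix.mul_add, Matrix.add_mul, mul_vecMulVec, vecMulVec_mul,
      Matrix.mul_one, Matrix.one_mul, mulVec_single_one, single_one_vecMul, add_apply,
      vecMulVec_apply, col_apply, row_apply]
    by_cases hj : j = j₀ <;> by_cases hi : i = i₀
    · subst hj hi
      simp only [hN, hv, hu, hd, of_apply, if_true, C_sub, C_1]
      ring
    · subst hj
      simp only [hN, hv, hd, of_apply, hi, if_true, if_false, hq i]
      linear_combination (-(X ^ d * q i)) * hCc
    · subst hi
      simp [hN, hv, hu, hj, hp j, mul_comm]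
    · simp [hN, hj, hi]
  · intro i hi
    rw [hq, mul_eq_zero, or_iff_right hX] at hi
    simp [hv, hi]
  · simp [hN]
  · intro j hj
    simp [hN, hj]
  · intro i hi
    simp [hN, hi]
  · intro j i hj hi
    simp [hN, hj, hi]

/-- The rows and columns of index less than `k` are in Smith normal form, with diagonal entries
`X ^ t l` dividing all the entries of the remaining block. -/
structure IsSmithUpTo (k : ℕ) (t : ℕ → ℕ) (M : Matrix (Fin m) (Fin n) K[X]) : Prop where
  off_diag : ∀ (j : Fin m) (i : Fin n), (j : ℕ) < k ∨ (i : ℕ) < k → (j : ℕ) ≠ i → M j i = 0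
  diag : ∀ (j : Fin m) (i : Fin n), (j : ℕ) = i → (j : ℕ) < k → M j i = X ^ t j
  dvd : ∀ (j : Fin m) (i : Fin n), k ≤ (j : ℕ) → k ≤ (i : ℕ) → ∀ l < k, X ^ t l ∣ M j i
  mono : ∀ l l', l ≤ l' → l' < k → t l ≤ t l'

theorem IsSmithUpTo.submatrix {k : ℕ} {t : ℕ → ℕ} {M : Matrix (Fin m) (Fin n) K[X]}
    (h : M.IsSmithUpTo k t) {f : Fin m → Fin m} {g : Fin n → Fin n}
    (hf : ∀ j : Fin m, (j : ℕ) < k → f j = j) (hf' : ∀ j : Fin m, k ≤ (j : ℕ) → k ≤ (f j : ℕ))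
    (hg : ∀ i : Fin n, (i : ℕ) < k → g i = i) (hg' : ∀ i : Fin n, k ≤ (i : ℕ) → k ≤ (g i : ℕ)) :
    (M.submatrix f g).IsSmithUpTo k t where
  off_diag j i hk hne := by
    have := hf j
    have := hf' j
    have := hg i
    have := hg' i
    apply h.off_diag <;> grind
  diag j i hji hk := by
    rw [submatrix_apply, hf j hk, hg i (hji ▸ hk)]
    exact h.diag j i hji hk
  dvd j i hj hi := h.dvd _ _ (hf' j hj) (hg' i hi)
  mono := h.mono

theorem IsSmithUpTo.exists_succ {k : ℕ} {t : ℕ → ℕ} {a : Fin m → ℕ} {s : Fin n → ℕ}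
    {M : Matrix (Fin m) (Fin n) K[X]} (hM : M.IsGradedHomog a s) (h : M.IsSmithUpTo k t)
    (hne : ∃ (j : Fin m) (i : Fin n), k ≤ (j : ℕ) ∧ k ≤ (i : ℕ) ∧ M j i ≠ 0) :
    ∃ (b : Fin m → ℕ) (c : Fin n → ℕ) (N : Matrix (Fin m) (Fin n) K[X]) (t' : ℕ → ℕ),
      GradedEquiv a s M b c N ∧ N.IsSmithUpTo (k + 1) t' := by
  classical
  have hmon (j i) : M j i = 0 ∨ ∃ d, ∃ c : K, c ≠ 0 ∧ M j i = C c * X ^ d :=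
    (hM j i).imp_right fun ⟨_, hc⟩ => ⟨_, hc⟩
  have hex : ∃ d, ∃ (j : Fin m) (i : Fin n), k ≤ (j : ℕ) ∧ k ≤ (i : ℕ) ∧
      ∃ c : K, c ≠ 0 ∧ M j i = C c * X ^ d := by
    obtain ⟨j, i, hj, hi, h0⟩ := hne
    obtain ⟨d, hd⟩ := (hmon j i).resolve_left h0
    exact ⟨d, j, i, hj, hi, hd⟩
  obtain ⟨j₁, i₁, hj₁, hi₁, c, hc, hd⟩ := Nat.find_spec hex
  have hmin (j : Fin m) (i : Fin n) (hj : k ≤ (j : ℕ)) (hi : k ≤ (i : ℕ)) :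
      X ^ Nat.find hex ∣ M j i := by
    obtain h0 | ⟨e, he⟩ := hmon j i
    · simp [h0]
    · obtain ⟨c', -, h'⟩ := id he
      rw [h']
      exact (pow_dvd_pow _ (Nat.find_min' hex ⟨j, i, hj, hi, he⟩)).mul_left _
  generalize Nat.find hex = d at hd hmin
  have htd (l) (hl : l < k) : t l ≤ d := by
    have hdvd := h.dvd j₁ i₁ hj₁ hi₁ l hl
    by_contra! hlt
    rw [hd, X_pow_dvd_iff] at hdvd
    simpa [hc] using hdvd d hlt
  obtain ⟨j₀, hj₀⟩ : ∃ j₀ : Fin m, (j₀ : ℕ) = k := ⟨⟨k, hj₁.trans_lt j₁.2⟩, rfl⟩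
  obtain ⟨i₀, hi₀⟩ : ∃ i₀ : Fin n, (i₀ : ℕ) = k := ⟨⟨k, hi₁.trans_lt i₁.2⟩, rfl⟩
  have hσ (j : Fin m) : (j : ℕ) < k → Equiv.swap j₀ j₁ j = j := by grind
  have hσ' (j : Fin m) : k ≤ (j : ℕ) → k ≤ (Equiv.swap j₀ j₁ j : ℕ) := by grind
  have hτ (i : Fin n) : (i : ℕ) < k → Equiv.swap i₀ i₁ i = i := by grind
  have hτ' (i : Fin n) : k ≤ (i : ℕ) → k ≤ (Equiv.swap i₀ i₁ i : ℕ) := by grind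
  have hE := hM.gradedEquiv_submatrix (Equiv.swap j₀ j₁) (Equiv.swap i₀ i₁)
  have h' := h.submatrix hσ hσ' hτ hτ'
  have hd' : M.submatrix (Equiv.swap j₀ j₁) (Equiv.swap i₀ i₁) j₀ i₀ = C c * X ^ d := by
    simpa using hd
  have hmin' (j : Fin m) (i : Fin n) (hj : k ≤ (j : ℕ)) (hi : k ≤ (i : ℕ)) :
      X ^ d ∣ M.submatrix (Equiv.swap j₀ j₁) (Equiv.swap i₀ i₁) j i :=
    hmin _ _ (hσ' j hj) (hτ' i hi)
  generalize M.submatrix (Equiv.swap j₀ j₁) (Equiv.swap i₀ i₁) = P at hE h' hd' hmin'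
  have hcol (j) : X ^ d ∣ P j i₀ := by
    rcases lt_or_ge (j : ℕ) k with hj | hj
    · simp [h'.off_diag j i₀ (.inl hj) (by omega)]
    · exact hmin' j i₀ hj hi₀.ge
  have hrow (i) : X ^ d ∣ P j₀ i := by
    rcases lt_or_ge (i : ℕ) k with hi | hi
    · simp [h'.off_diag j₀ i (.inr hi) (by omega)]
    · exact hmin' j₀ i hj₀.ge hi
  obtain ⟨v, N, hN, hv, hNd, hNcol, hNrow, hNrest⟩ :=
    hE.1.exists_gradedEquiv_clear hc hd' hcol hrow
  have hNlt (j : Fin m) (i : Fin n) (hk : (j : ℕ) < k ∨ (i : ℕ) < k) (hj : (j : ℕ) ≠ k)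
      (hi : (i : ℕ) ≠ k) : N j i = P j i := by
    rw [hNrest j i (by grind) (by grind)]
    rcases hk with hk | hk
    · simp [h'.off_diag j i₀ (.inl hk) (by omega)]
    · simp [hv i (h'.off_diag j₀ i (.inr hk) (by omega))]
  have hNdvd (j : Fin m) (i : Fin n) (hj : k < (j : ℕ)) (hi : k < (i : ℕ)) : X ^ d ∣ N j i := by
    rw [hNrest j i (by grind) (by grind)]
    exact (hmin' j i hj.le hi.le).add ((hcol j).mul_right _)
  have htu (l) (hl : l < k + 1) : Function.update t k d l ≤ d := by
    rcases eq_or_ne l k with rfl | hlk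
    · simp
    · simpa [hlk] using htd l (by omega)
  refine ⟨_, _, N, Function.update t k d, hE.trans hN, ?_, ?_, ?_, ?_⟩
  · intro j i hk hji
    by_cases hj : j = j₀
    · exact hj ▸ hNrow i (by grind)
    by_cases hi : i = i₀
    · exact hi ▸ hNcol j hj
    rw [hNlt j i (by grind) (by grind) (by grind)]
    exact h'.off_diag j i (by grind) hji
  · intro j i hji hk
    by_cases hj : j = j₀
    · obtain rfl : i = i₀ := by grind
      simp [hj, hj₀, hNd]
    · have hlt : (j : ℕ) < k := by grind
      rw [hNlt j i (.inl hlt) hlt.ne (by omega), h'.diag j i hji hlt,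
        Function.update_of_ne hlt.ne]
  · intro j i hj hi l hl
    exact (pow_dvd_pow _ (htu l hl)).trans (hNdvd j i hj hi)
  · intro l l' hl hl'
    rcases eq_or_ne l' k with rfl | hne'
    · simpa using htu l (by omega)
    · rw [Function.update_of_ne hne', Function.update_of_ne (by omega)]
      exact h.mono l l' hl (by omega)

theorem IsGradedHomog.exists_isSmithUpTo {a : Fin m → ℕ} {s : Fin n → ℕ}
    {M : Matrix (Fin m) (Fin n) K[X]} (hM : M.IsGradedHomog a s) :
    ∃ (b : Fin m → ℕ) (c : Fin n → ℕ) (N : Matrix (Fin m) (Fin n) K[X]) (r : ℕ) (t : ℕ → ℕ),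
      r ≤ min m n ∧ GradedEquiv a s M b c N ∧ N.IsSmithUpTo r t ∧
      ∀ (j : Fin m) (i : Fin n), r ≤ (j : ℕ) → r ≤ (i : ℕ) → N j i = 0 := by
  classical
  let Q : ℕ → Prop := fun k => ∃ (b : Fin m → ℕ) (c : Fin n → ℕ)
    (N : Matrix (Fin m) (Fin n) K[X]) (t : ℕ → ℕ), GradedEquiv a s M b c N ∧ N.IsSmithUpTo k t
  have hQ0 : Q 0 := ⟨a, s, M, fun _ => 0, hM.gradedEquiv_self,
    ⟨by simp, by simp, by simp, by simp⟩⟩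
  obtain ⟨b, c, N, t, hN, ht⟩ := Nat.findGreatest_spec (Nat.zero_le (min m n)) hQ0
  refine ⟨b, c, N, _, t, Nat.findGreatest_le _, hN, ht, ?_⟩
  by_contra! hne
  obtain ⟨j, i, hj, hi, h0⟩ := hne
  obtain ⟨b', c', N', t', hN', ht'⟩ := ht.exists_succ hN.1 ⟨j, i, hj, hi, h0⟩
  have hle : Nat.findGreatest Q (min m n) + 1 ≤ min m n :=
    le_min (by omega) (by omega)
  have := Nat.le_findGreatest (P := Q) hle ⟨b', c', N', t', hN.trans hN', ht'⟩
  omega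

end Matrix

theorem exists_graded_smith_normal_decomposition {K : Type*} [Field K] {m n : ℕ}
    (a : Fin m → ℕ) (s : Fin n → ℕ) (M : Matrix (Fin m) (Fin n) K[X])
    (hM : Matrix.IsGradedHomog a s M) :
    ∃ (U : GL (Fin m) K[X]) (V : GL (Fin n) K[X])
      (b : Fin m → ℕ) (c : Fin n → ℕ) (r : ℕ) (_ : r ≤ min m n) (t : Fin r → ℕ),
      Monotone t ∧
      Matrix.IsGradedHomog a b (U : Matrix (Fin m) (Fin m) K[X]) ∧
      Matrix.IsGradedHomog s c (V : Matrix (Fin n) (Fin n) K[X]) ∧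
      (∀ (j : Fin m) (i : Fin n), (j : ℕ) ≠ (i : ℕ) →
        (((U⁻¹ : GL (Fin m) K[X]) : Matrix (Fin m) (Fin m) K[X]) * M *
          (V : Matrix (Fin n) (Fin n) K[X])) j i = 0) ∧
      (∀ (j : Fin m) (i : Fin n), (j : ℕ) = (i : ℕ) → ∀ h : (j : ℕ) < r,
        (((U⁻¹ : GL (Fin m) K[X]) : Matrix (Fin m) (Fin m) K[X]) * M *
          (V : Matrix (Fin n) (Fin n) K[X])) j i = X ^ t ⟨(j : ℕ), h⟩) ∧
      (∀ (j : Fin m) (i : Fin n), (j : ℕ) = (i : ℕ) → r ≤ (j : ℕ) →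
        (((U⁻¹ : GL (Fin m) K[X]) : Matrix (Fin m) (Fin m) K[X]) * M *
          (V : Matrix (Fin n) (Fin n) K[X])) j i = 0) := by
  obtain ⟨b, c, N, r, t, hr, ⟨-, U, V, hU, hV, hUV⟩, ht, h0⟩ := hM.exists_isSmithUpTo
  have hD : ((U⁻¹ : GL (Fin m) K[X]) : Matrix (Fin m) (Fin m) K[X]) * M *
      (V : Matrix (Fin n) (Fin n) K[X]) = N := by
    rw [Matrix.mul_assoc, hUV, ← Matrix.mul_assoc, ← Units.val_mul, inv_mul_cancel,
      Units.val_one, Matrix.one_mul]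
  refine ⟨U, V, b, c, r, hr, fun l => t l, fun l l' hl => ht.mono l l' hl l'.2, hU, hV, ?_⟩
  rw [hD]
  refine ⟨fun j i hji => ?_, fun j i hji hj => ht.diag j i hji hj,
    fun j i hji hj => h0 j i hj (hji ▸ hj)⟩
  by_cases hk : (j : ℕ) < r ∨ (i : ℕ) < r
  · exact ht.off_diag j i hk hji
  · exact h0 j i (by omega) (by omega)
end

section
/- Invariant factor decomposition from a Smith Normal Decomposition: let M ∈ Matrix (Fin m) (Fin n) K[X], and suppose there are invertible matrices U ∈ GL (Fin m) K[X] and V ∈ GL (Fin n) K[X], a natural number r ≤ min m n, and t : Fin r → ℕ such that D := U⁻¹ * M * V satisfies D j i = 0 for j ≠ i, D j j = X^(t j) for diagonal indices j < r, and D j j = 0 for diagonal indices j ≥ r. Then the cokernel of the K[X]-linear map (Fin n → K[X]) →ₗ[K[X]] (Fin m → K[X]) determined by M is isomorphic as a K[X]-module to the direct sum (⨁_{j=0}^{r-1} K[X] ⧸ ideal span {X^(t j)}) ⊕ (Fin (m - r) → K[X]). -/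
open Polynomial DirectSum

namespace Matrix

variable {R : Type*} [CommRing R]

/-- Multiplying a matrix by invertible matrices on both sides does not change its cokernel. -/
noncomputable def cokernelEquivOfGLMul {m n : Type*} [Fintype m] [DecidableEq m] [Fintype n]
    [DecidableEq n] (M : Matrix m n R) (P : GL m R) (Q : GL n R) :
    ((m → R) ⧸ LinearMap.range M.mulVecLin) ≃ₗ[R]
      ((m → R) ⧸ LinearMap.range ((P : Matrix m m R) * M * (Q : Matrix n n R)).mulVecLin) :=
  Submodule.Quotient.equiv _ _ (LinearMap.GeneralLinearGroup.generalLinearEquiv R _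
      (GeneralLinearGroup.toLin P)) <| by
    ext x
    simp only [Submodule.mem_map, LinearMap.mem_range, mulVecLin_apply]
    constructor
    · rintro ⟨_, ⟨y, rfl⟩, rfl⟩
      refine ⟨((Q⁻¹ : GL n R) : Matrix n n R) *ᵥ y, ?_⟩
      rw [mulVec_mulVec, Matrix.mul_assoc, ← Units.val_mul, mul_inv_cancel, Units.val_one,
        Matrix.mul_one, ← mulVec_mulVec]
      rfl
    · rintro ⟨y, rfl⟩
      refine ⟨M *ᵥ ((Q : Matrix n n R) *ᵥ y), ⟨_, rfl⟩, ?_⟩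
      rw [← mulVec_mulVec, ← mulVec_mulVec]
      rfl

variable {m n r : ℕ} {D : Matrix (Fin m) (Fin n) R}

theorem mulVec_apply_of_rectangular_diagonal
    (hoff : ∀ (j : Fin m) (i : Fin n), (j : ℕ) ≠ (i : ℕ) → D j i = 0) (y : Fin n → R)
    {j : Fin m} {i : Fin n} (hji : (j : ℕ) = i) : (D *ᵥ y) j = D j i * y i := by
  rw [mulVec, dotProduct]
  exact Fintype.sum_eq_single i fun k hk => by
    rw [hoff j k fun h => hk (Fin.ext (h.symm.trans hji)), zero_mul]

theorem mem_range_mulVecLin_of_rectangular_diagonal (hm : r ≤ m) (hn : r ≤ n) {d : Fin r → R}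
    (hoff : ∀ (j : Fin m) (i : Fin n), (j : ℕ) ≠ (i : ℕ) → D j i = 0)
    (hdiag : ∀ j : Fin r, D (j.castLE hm) (j.castLE hn) = d j)
    (hzero : ∀ (j : Fin m) (i : Fin n), (j : ℕ) = (i : ℕ) → r ≤ (j : ℕ) → D j i = 0)
    {x : Fin m → R} :
    x ∈ LinearMap.range D.mulVecLin ↔
      (∀ j : Fin r, d j ∣ x (j.castLE hm)) ∧ ∀ j : Fin m, r ≤ (j : ℕ) → x j = 0 := by
  have happly (y : Fin n → R) (j : Fin r) :
      (D *ᵥ y) (j.castLE hm) = d j * y (j.castLE hn) := by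
    rw [mulVec_apply_of_rectangular_diagonal hoff y (i := j.castLE hn) rfl, hdiag]
  have hvanish (y : Fin n → R) (j : Fin m) (hj : r ≤ (j : ℕ)) : (D *ᵥ y) j = 0 := by
    rw [mulVec, dotProduct]
    refine Finset.sum_eq_zero fun i _ => ?_
    by_cases h : (j : ℕ) = i
    · rw [hzero j i h hj, zero_mul]
    · rw [hoff j i h, zero_mul]
  constructor
  · rintro ⟨y, rfl⟩
    exact ⟨fun j => ⟨_, happly y j⟩, hvanish y⟩
  · rintro ⟨hdvd, hx⟩
    choose c hc using hdvd
    refine ⟨fun i => if h : (i : ℕ) < r then c ⟨i, h⟩ else 0, funext fun j => ?_⟩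
    rw [mulVecLin_apply]
    by_cases hj : (j : ℕ) < r
    · refine (happly _ ⟨j, hj⟩).trans ?_
      simpa [hj] using (hc ⟨j, hj⟩).symm
    · rw [hvanish _ j (not_lt.mp hj), hx j (not_lt.mp hj)]

/-- The cokernel of a rectangular diagonal matrix whose nonzero entries lie among the first `r`
diagonal entries `d`. -/
theorem nonempty_cokernel_equiv_of_rectangular_diagonal (hm : r ≤ m) (hn : r ≤ n) {d : Fin r → R}
    (hoff : ∀ (j : Fin m) (i : Fin n), (j : ℕ) ≠ (i : ℕ) → D j i = 0)
    (hdiag : ∀ j : Fin r, D (j.castLE hm) (j.castLE hn) = d j)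
    (hzero : ∀ (j : Fin m) (i : Fin n), (j : ℕ) = (i : ℕ) → r ≤ (j : ℕ) → D j i = 0) :
    Nonempty (((Fin m → R) ⧸ LinearMap.range D.mulVecLin) ≃ₗ[R]
      (⨁ j : Fin r, R ⧸ Ideal.span {d j}) × (Fin (m - r) → R)) := by
  let φ : (Fin m → R) →ₗ[R] (∀ j : Fin r, R ⧸ Ideal.span {d j}) × (Fin (m - r) → R) :=
    (LinearMap.pi fun j => (Ideal.span {d j}).mkQ ∘ₗ LinearMap.proj (j.castLE hm)).prod
      (LinearMap.funLeft R R fun i => ⟨r + i, by omega⟩)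
  have hker : LinearMap.range D.mulVecLin = LinearMap.ker φ := by
    ext x
    rw [mem_range_mulVecLin_of_rectangular_diagonal hm hn hoff hdiag hzero, LinearMap.mem_ker,
      Prod.ext_iff, funext_iff, funext_iff]
    refine and_congr (forall_congr' fun j => ?_) ⟨fun h i => h _ (Nat.le_add_right _ _),
      fun h j hj => ?_⟩
    · exact Ideal.mem_span_singleton.symm.trans (Submodule.Quotient.mk_eq_zero _).symm
    · have hi := h ⟨j - r, by omega⟩
      simpa [φ, LinearMap.funLeft_apply, Nat.add_sub_cancel' hj] using hi
  have hsurj : Function.Surjective φ := by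
    rintro ⟨a, b⟩
    choose c hc using fun j => Submodule.Quotient.mk_surjective _ (a j)
    refine ⟨fun j => if h : (j : ℕ) < r then c ⟨j, h⟩ else b ⟨j - r, by omega⟩,
      Prod.ext (funext fun j => ?_) (funext fun i => ?_)⟩
    · simpa [φ] using hc j
    · simp [φ, LinearMap.funLeft_apply]
  exact ⟨(Submodule.quotEquivOfEq _ _ hker).trans <| (φ.quotKerEquivOfSurjective hsurj).trans <|
    (DirectSum.linearEquivFunOnFintype R (Fin r) _).symm.prodCongr (LinearEquiv.refl R _)⟩

end Matrix

theorem cokernel_iso_of_smith_normal_decomposition {K : Type*} [Field K] {m n : ℕ}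
    (M : Matrix (Fin m) (Fin n) K[X])
    (U : GL (Fin m) K[X]) (V : GL (Fin n) K[X])
    (r : ℕ) (hr : r ≤ min m n) (t : Fin r → ℕ)
    (hoff : ∀ (j : Fin m) (i : Fin n), (j : ℕ) ≠ (i : ℕ) →
      (((U⁻¹ : GL (Fin m) K[X]) : Matrix (Fin m) (Fin m) K[X]) * M *
        (V : Matrix (Fin n) (Fin n) K[X])) j i = 0)
    (hdiag : ∀ (j : Fin m) (i : Fin n), (j : ℕ) = (i : ℕ) → ∀ h : (j : ℕ) < r,
      (((U⁻¹ : GL (Fin m) K[X]) : Matrix (Fin m) (Fin m) K[X]) * M *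
        (V : Matrix (Fin n) (Fin n) K[X])) j i = X ^ t ⟨(j : ℕ), h⟩)
    (hzero : ∀ (j : Fin m) (i : Fin n), (j : ℕ) = (i : ℕ) → r ≤ (j : ℕ) →
      (((U⁻¹ : GL (Fin m) K[X]) : Matrix (Fin m) (Fin m) K[X]) * M *
        (V : Matrix (Fin n) (Fin n) K[X])) j i = 0) :
    Nonempty (((Fin m → K[X]) ⧸ LinearMap.range M.mulVecLin) ≃ₗ[K[X]]
      (⨁ j : Fin r, K[X] ⧸ Ideal.span {(X : K[X]) ^ t j}) × (Fin (m - r) → K[X])) := by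
  obtain ⟨hm, hn⟩ := le_min_iff.mp hr
  obtain ⟨e⟩ := Matrix.nonempty_cokernel_equiv_of_rectangular_diagonal hm hn hoff
    (fun j => hdiag (j.castLE hm) (j.castLE hn) rfl j.isLt) hzero
  exact ⟨(Matrix.cokernelEquivOfGLMul M U⁻¹ V).trans e⟩
end

section
/- Graded structure theorem (internal form): let K be a field and let M be a finitely generated module over K[X] equipped with a family of K-subspaces M_d (d ∈ ℕ) such that M is the internal direct sum of the M_d as a K-vector space and X • M_d ⊆ M_{d+1} for all d. Then there exist finitely many elements m₁, …, m_k of M, each homogeneous (i.e., m_j ∈ M_{d_j} for some d_j ∈ ℕ), such that M is the internal direct sum of the cyclic K[X]-submodules K[X] • m₁, …, K[X] • m_k, and for each j the annihilator of m_j in K[X] is either the zero ideal or the ideal generated by X^(t_j) for some t_j ∈ ℕ; moreover the indices can be ordered so that the nonzero annihilator ideals form a divisibility chain X^(t_1) ∣ X^(t_2) ∣ ⋯. -/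
open Polynomial

section ActionOfX

variable {K M : Type*} [Field K] [AddCommGroup M] [Module K[X] M]

open Classical in
/-- The least `n` such that `X ^ n` kills `x`, or `⊤` if there is none. -/
noncomputable def xOrder (K : Type*) {M : Type*} [Field K] [AddCommGroup M] [Module K[X] M]
    (x : M) : ℕ∞ :=
  if h : ∃ n : ℕ, (X : K[X]) ^ n • x = 0 then (Nat.find h : ℕ∞) else ⊤

theorem xOrder_le_iff {x : M} {n : ℕ} : xOrder K x ≤ n ↔ (X : K[X]) ^ n • x = 0 := by
  classical
  unfold xOrder
  split_ifs with h
  · rw [Nat.cast_le, Nat.find_le_iff]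
    refine ⟨?_, fun hn => ⟨n, le_rfl, hn⟩⟩
    rintro ⟨m, hm, hx⟩
    rw [← Nat.sub_add_cancel hm, pow_add, mul_smul, hx, smul_zero]
  · simpa using fun hn => h ⟨n, hn⟩

theorem X_pow_smul_mem [Module K M] {𝒜 : ℕ → Submodule K M}
    (hshift : ∀ (d : ℕ) (x : M), x ∈ 𝒜 d → (X : K[X]) • x ∈ 𝒜 (d + 1))
    {d : ℕ} {x : M} (hx : x ∈ 𝒜 d) (n : ℕ) : (X : K[X]) ^ n • x ∈ 𝒜 (d + n) := by
  induction n with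
  | zero => simpa using hx
  | succ n ih =>
    rw [pow_succ', mul_smul]
    exact hshift _ _ ih

end ActionOfX

theorem isInternal_span_singleton {R M ι : Type*} [CommRing R] [AddCommGroup M] [Module R M]
    [Fintype ι] [DecidableEq ι] {x : ι → M} (hspan : Submodule.span R (Set.range x) = ⊤)
    (hrel : ∀ p : ι → R, ∑ i, p i • x i = 0 → ∀ i, p i • x i = 0) :
    DirectSum.IsInternal fun i => Submodule.span R {x i} := by
  refine DirectSum.isInternal_submodule_of_iSupIndep_of_iSup_eq_top ?_ ?_
  · classical
    refine iSupIndep_of_dfinsupp_lsum_injective _ ?_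
    rw [← LinearMap.ker_eq_bot, LinearMap.ker_eq_bot']
    intro v hv
    choose p hp using fun i => Submodule.mem_span_singleton.1 (v i).2
    have hsum : ∑ i, p i • x i = 0 := by
      rw [DFinsupp.lsum_apply_apply, DFinsupp.sumAddHom_apply,
        DFinsupp.sum_eq_sum_fintype _ (fun i => by simp)] at hv
      simpa [hp] using hv
    ext i
    rw [← hp i, hrel p hsum i]
    rfl
  · rw [← hspan, Submodule.span_range_eq_iSup]

section Graded

variable {K M : Type*} [Field K] [AddCommGroup M] [Module K M] (𝒜 : ℕ → Submodule K M)
  [DirectSum.Decomposition 𝒜]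

/-- The projection of a graded vector space onto its part of degree `D`. -/
noncomputable def gradedComponent (D : ℕ) : M →ₗ[K] M :=
  (𝒜 D).subtype ∘ₗ DirectSum.component K ℕ (fun i => 𝒜 i) D ∘ₗ
    (DirectSum.decomposeLinearEquiv 𝒜).toLinearMap

theorem gradedComponent_apply (D : ℕ) (x : M) :
    gradedComponent 𝒜 D x = (DirectSum.decompose 𝒜 x D : M) := rfl

variable {𝒜}

theorem eq_zero_of_gradedComponent_eq_zero {x : M} (h : ∀ D, gradedComponent 𝒜 D x = 0) :
    x = 0 := by
  classical
  rw [← DirectSum.sum_support_decompose 𝒜 x]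
  exact Finset.sum_eq_zero fun D _ => h D

variable [Module K[X] M]

variable (𝒜) in
/-- A tuple of homogeneous elements that generates the module. -/
def IsHomogeneousGenerating {ι : Type*} (x : ι → M) : Prop :=
  (∀ i, ∃ d, x i ∈ 𝒜 d) ∧ Submodule.span K[X] (Set.range x) = ⊤

variable (𝒜) in
theorem exists_isHomogeneousGenerating [Module.Finite K[X] M] :
    ∃ (n : ℕ) (x : Fin n → M), IsHomogeneousGenerating 𝒜 x := by
  classical
  obtain ⟨S, hS⟩ := Module.Finite.fg_top (R := K[X]) (M := M)
  let T : Finset M := S.biUnion fun s =>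
    (DirectSum.decompose 𝒜 s).support.image fun i => (DirectSum.decompose 𝒜 s i : M)
  refine ⟨T.card, fun i => T.equivFin.symm i, fun i => ?_, ?_⟩
  · obtain ⟨s, -, hs⟩ := Finset.mem_biUnion.1 (T.equivFin.symm i).2
    obtain ⟨d, -, hd⟩ := Finset.mem_image.1 hs
    refine ⟨d, ?_⟩
    change (T.equivFin.symm i : M) ∈ 𝒜 d
    rw [← hd]
    exact (DirectSum.decompose 𝒜 s d).2
  · rw [eq_top_iff, ← hS, Submodule.span_le]
    intro s hs
    rw [← DirectSum.sum_support_decompose 𝒜 s]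
    refine Submodule.sum_mem _ fun i hi => Submodule.subset_span ?_
    have hT : (DirectSum.decompose 𝒜 s i : M) ∈ T :=
      Finset.mem_biUnion.2 ⟨s, hs, Finset.mem_image_of_mem _ hi⟩
    exact ⟨T.equivFin ⟨_, hT⟩, by simp⟩

variable [IsScalarTower K K[X] M]

theorem gradedComponent_smul
    (hshift : ∀ (d : ℕ) (x : M), x ∈ 𝒜 d → (X : K[X]) • x ∈ 𝒜 (d + 1))
    {d : ℕ} {x : M} (hx : x ∈ 𝒜 d) (D : ℕ) (p : K[X]) :
    gradedComponent 𝒜 D (p • x) =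
      if d ≤ D then p.coeff (D - d) • (X : K[X]) ^ (D - d) • x else 0 := by
  induction p using Polynomial.induction_on' with
  | add p q hp hq =>
    rw [add_smul, map_add, hp, hq]
    split_ifs
    · rw [coeff_add, add_smul]
    · rw [add_zero]
  | monomial n c =>
    have hn := X_pow_smul_mem hshift hx n
    rw [← smul_X_eq_monomial, smul_assoc, map_smul, gradedComponent_apply]
    by_cases h : d + n = D
    · subst h
      rw [DirectSum.decompose_of_mem_same 𝒜 hn]
      simp
    · rw [DirectSum.decompose_of_mem_ne 𝒜 hn h, smul_zero]
      split_ifs with hd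
      · rw [coeff_smul, coeff_X_pow, if_neg (by omega), smul_zero, zero_smul]
      · rfl

theorem coeff_smul_X_pow_smul_eq_zero
    (hshift : ∀ (d : ℕ) (x : M), x ∈ 𝒜 d → (X : K[X]) • x ∈ 𝒜 (d + 1))
    {d : ℕ} {x : M} (hx : x ∈ 𝒜 d) {p : K[X]} (hp : p • x = 0) (n : ℕ) :
    p.coeff n • (X : K[X]) ^ n • x = 0 := by
  have h := gradedComponent_smul hshift hx (d + n) p
  rw [hp, map_zero] at h
  simpa using h.symm

theorem torsionOf_eq_bot_of_xOrder_eq_top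
    (hshift : ∀ (d : ℕ) (x : M), x ∈ 𝒜 d → (X : K[X]) • x ∈ 𝒜 (d + 1))
    {d : ℕ} {x : M} (hx : x ∈ 𝒜 d) (h : xOrder K x = ⊤) :
    Ideal.torsionOf K[X] M x = ⊥ := by
  rw [eq_bot_iff]
  intro p hp
  rw [Ideal.mem_torsionOf_iff] at hp
  refine (Submodule.mem_bot _).2 (Polynomial.ext fun n => ?_)
  refine (smul_eq_zero.1 (coeff_smul_X_pow_smul_eq_zero hshift hx hp n)).resolve_right ?_
  rw [← xOrder_le_iff, h]
  simp

theorem torsionOf_eq_span_of_xOrder_eq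
    (hshift : ∀ (d : ℕ) (x : M), x ∈ 𝒜 d → (X : K[X]) • x ∈ 𝒜 (d + 1))
    {d : ℕ} {x : M} (hx : x ∈ 𝒜 d) {t : ℕ} (h : xOrder K x = t) :
    Ideal.torsionOf K[X] M x = Ideal.span {(X : K[X]) ^ t} := by
  ext p
  rw [Ideal.mem_torsionOf_iff, Ideal.mem_span_singleton]
  constructor
  · intro hp
    rw [X_pow_dvd_iff]
    intro n hn
    refine (smul_eq_zero.1 (coeff_smul_X_pow_smul_eq_zero hshift hx hp n)).resolve_right ?_
    rw [← xOrder_le_iff, h, Nat.cast_le]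
    omega
  · rintro ⟨q, rfl⟩
    rw [mul_comm, mul_smul, xOrder_le_iff.1 h.le, smul_zero]

/-- Replacing a generator of largest degree occurring in a homogeneous relation lowers its
order. -/
theorem exists_update_xOrder_lt {ι : Type*} [Fintype ι] [DecidableEq ι]
    (hshift : ∀ (d : ℕ) (x : M), x ∈ 𝒜 d → (X : K[X]) • x ∈ 𝒜 (d + 1))
    {x : ι → M} (hx : IsHomogeneousGenerating 𝒜 x) {p : ι → K[X]}
    (hp : ∑ i, p i • x i = 0) (hne : ∃ i, p i • x i ≠ 0) :
    ∃ (i : ι) (y : M), IsHomogeneousGenerating 𝒜 (Function.update x i y) ∧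
      xOrder K y < xOrder K (x i) := by
  obtain ⟨hhom, hspan⟩ := hx
  choose d hd using hhom
  obtain ⟨i₀, hi₀⟩ := hne
  obtain ⟨D, hD⟩ : ∃ D, gradedComponent 𝒜 D (p i₀ • x i₀) ≠ 0 := by
    contrapose! hi₀
    exact eq_zero_of_gradedComponent_eq_zero hi₀
  set z : ι → M := fun i => gradedComponent 𝒜 D (p i • x i) with hz
  set c : ι → K := fun i => (p i).coeff (D - d i) with hc
  have hzsum : ∑ i, z i = 0 := by rw [hz, ← map_sum, hp, map_zero]
  have hz_ne : ∀ i, z i ≠ 0 → d i ≤ D ∧ z i = c i • (X : K[X]) ^ (D - d i) • x i := by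
    intro i hi
    have h := gradedComponent_smul hshift (hd i) D (p i)
    split_ifs at h with hdi
    · exact ⟨hdi, h⟩
    · exact absurd h hi
  classical
  obtain ⟨i, hi, hmax⟩ := (Finset.univ.filter fun i => z i ≠ 0).exists_max_image d
    ⟨i₀, by simpa using hD⟩
  replace hi : z i ≠ 0 := by simpa using hi
  replace hmax : ∀ j, z j ≠ 0 → d j ≤ d i := fun j hj => hmax j (by simpa using hj)
  obtain ⟨hiD, hzi⟩ := hz_ne i hi
  have hci : c i ≠ 0 := fun h => hi (by rw [hzi, h, zero_smul])
  have hxi : (X : K[X]) ^ (D - d i) • x i ≠ 0 := fun h => hi (by rw [hzi, h, smul_zero])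
  let w : ι → M := fun j =>
    if z j ≠ 0 then ((c i)⁻¹ * c j) • (X : K[X]) ^ (d i - d j) • x j else 0
  have hwi : w i = x i := by simp [w, hi, hci]
  have hw_mem : ∀ j, w j ∈ 𝒜 (d i) := by
    intro j
    by_cases hj : z j = 0
    · simp [w, hj]
    · simp only [w, if_pos hj]
      have := X_pow_smul_mem hshift (hd j) (d i - d j)
      rw [Nat.add_sub_cancel' (hmax j hj)] at this
      exact (𝒜 (d i)).smul_mem _ this
  have hw_smul : ∀ j, (X : K[X]) ^ (D - d i) • w j = (c i)⁻¹ • z j := by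
    intro j
    by_cases hj : z j = 0
    · simp [w, hj]
    · simp only [w, if_pos hj]
      have hdj := hmax j hj
      rw [smul_algebra_smul_comm, ← mul_smul, ← pow_add, (hz_ne j hj).2, mul_smul,
        show D - d i + (d i - d j) = D - d j by omega]
  refine ⟨i, ∑ j, w j, ⟨?_, ?_⟩, ?_⟩
  · intro j
    obtain rfl | hj := eq_or_ne j i
    · exact ⟨d j, by simpa using Submodule.sum_mem _ fun j _ => hw_mem j⟩
    · exact ⟨d j, by simpa [hj] using hd j⟩
  · set N := Submodule.span K[X] (Set.range (Function.update x i (∑ j, w j)))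
    have hmem : ∀ j, Function.update x i (∑ j, w j) j ∈ N :=
      fun j => Submodule.subset_span ⟨j, rfl⟩
    have hx_ne : ∀ j, j ≠ i → x j ∈ N := fun j hj => by simpa [hj] using hmem j
    rw [eq_top_iff, ← hspan, Submodule.span_le]
    rintro _ ⟨j, rfl⟩
    obtain rfl | hj := eq_or_ne j i
    · have hy : ∑ k, w k ∈ N := by simpa using hmem j
      rw [← Finset.add_sum_erase _ _ (Finset.mem_univ j), hwi] at hy
      refine (N.add_mem_iff_left (Submodule.sum_mem _ fun k hk => ?_)).1 hy
      simp only [w]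
      split_ifs
      · exact N.smul_of_tower_mem _ (N.smul_mem _ (hx_ne k (Finset.ne_of_mem_erase hk)))
      · exact N.zero_mem
    · exact hx_ne j hj
  · refine lt_of_le_of_lt (xOrder_le_iff.2 ?_) (not_le.1 fun h => hxi (xOrder_le_iff.1 h))
    simp only [Finset.smul_sum, hw_smul]
    rw [← Finset.smul_sum, hzsum, smul_zero]

variable (𝒜) in
theorem exists_isHomogeneousGenerating_independent [Module.Finite K[X] M]
    (hshift : ∀ (d : ℕ) (x : M), x ∈ 𝒜 d → (X : K[X]) • x ∈ 𝒜 (d + 1)) :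
    ∃ (n : ℕ) (x : Fin n → M), IsHomogeneousGenerating 𝒜 x ∧
      ∀ p : Fin n → K[X], ∑ i, p i • x i = 0 → ∀ i, p i • x i = 0 := by
  obtain ⟨n, x₀, hx₀⟩ := exists_isHomogeneousGenerating 𝒜
  obtain ⟨x, hx, hmin⟩ := exists_minimalFor_of_wellFoundedLT (IsHomogeneousGenerating 𝒜)
    (fun (x : Fin n → M) i => xOrder K (x i)) ⟨x₀, hx₀⟩
  refine ⟨n, x, hx, fun p hp => ?_⟩
  by_contra! hne
  obtain ⟨i, y, hy, hlt⟩ := exists_update_xOrder_lt hshift hx hp hne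
  refine hlt.not_ge ?_
  have hle := hmin hy fun j => ?_
  · simpa using hle i
  · obtain rfl | hj := eq_or_ne j i
    · simpa using hlt.le
    · simp [hj]

end Graded

theorem exists_cutoff_of_monotone {k : ℕ} {f : Fin k → ℕ∞} (hf : Monotone f) :
    ∃ r ≤ k, (∀ j : Fin k, (j : ℕ) < r → f j ≠ ⊤) ∧ ∀ j : Fin k, r ≤ (j : ℕ) → f j = ⊤ := by
  classical
  have hex : ∃ r, ∀ j : Fin k, r ≤ (j : ℕ) → f j = ⊤ := ⟨k, fun j hj => absurd j.2 hj.not_gt⟩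
  refine ⟨Nat.find hex, Nat.find_min' hex fun j hj => absurd j.2 hj.not_gt, fun j hj htop => ?_,
    Nat.find_spec hex⟩
  exact Nat.find_min hex hj fun i hi => top_le_iff.1 (htop ▸ hf hi)

theorem graded_structure_theorem_internal {K : Type*} [Field K]
    (M : Type*) [AddCommGroup M] [Module K[X] M] [Module K M]
    [IsScalarTower K K[X] M] [Module.Finite K[X] M]
    (𝒜 : ℕ → Submodule K M)
    (hinternal : DirectSum.IsInternal 𝒜)
    (hshift : ∀ (d : ℕ) (x : M), x ∈ 𝒜 d → (X : K[X]) • x ∈ 𝒜 (d + 1)) :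
    ∃ (k : ℕ) (g : Fin k → M) (d : Fin k → ℕ),
      (∀ j, g j ∈ 𝒜 (d j)) ∧
      DirectSum.IsInternal (fun j : Fin k => Submodule.span K[X] {g j}) ∧
      ∃ (r : ℕ) (_ : r ≤ k) (t : Fin k → ℕ),
        (∀ j : Fin k, (j : ℕ) < r →
          Ideal.torsionOf K[X] M (g j) = Ideal.span {(X : K[X]) ^ t j}) ∧
        (∀ j : Fin k, r ≤ (j : ℕ) → Ideal.torsionOf K[X] M (g j) = ⊥) ∧
        (∀ j j' : Fin k, j ≤ j' → (j' : ℕ) < r →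
          (X : K[X]) ^ t j ∣ (X : K[X]) ^ t j') := by
  let _ := hinternal.chooseDecomposition
  obtain ⟨k, x, ⟨hhom, hspan⟩, hrel⟩ := exists_isHomogeneousGenerating_independent 𝒜 hshift
  let σ := Tuple.sort fun i => xOrder K (x i)
  have hmono : Monotone fun i => xOrder K (x (σ i)) := Tuple.monotone_sort fun i => xOrder K (x i)
  choose d hd using fun j => hhom (σ j)
  obtain ⟨r, hrk, hlt, hge⟩ := exists_cutoff_of_monotone hmono
  refine ⟨k, x ∘ σ, d, hd, isInternal_span_singleton ?_ fun p hp j => ?_, r, hrk,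
    fun j => (xOrder K (x (σ j))).toNat, fun j hj => ?_, fun j hj => ?_, fun j j' hjj hj' => ?_⟩
  · rw [σ.surjective.range_comp, hspan]
  · have h := hrel (p ∘ σ.symm) (by rw [← Equiv.sum_comp σ]; simpa using hp) (σ j)
    simpa using h
  · exact torsionOf_eq_span_of_xOrder_eq hshift (hd j) (ENat.natCast_toNat (hlt j hj)).symm
  · exact torsionOf_eq_bot_of_xOrder_eq_top hshift (hd j) (hge j hj)
  · exact pow_dvd_pow _ (ENat.toNat_le_toNat (hmono hjj) (hlt j' hj'))
end
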